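/- arXiv:1201.5509 — 2 statements merged into one kernel-verified Lean document; each statement's English description precedes it below -/
import Mathlib

section
/- Let S be a weakly satisfactory ρ-structure, Θ a ρ-theory, and σ a ρ-sentence. If S ⊨* Θ and Θ ⊢ σ, then S ⊨* σ. -/
open FirstOrder FirstOrder.Language

namespace PaperSat

variable {L : Language} {α : Type*}

/-- A formula in context: a bounded formula together with its number of bound variables. -/
abbrev Fml (L : Language) (α : Type*) : Type _ := Σ n, L.BoundedFormula α n

/-- `Sub φ ψ` means that `φ` is a subformula (or subexpression) of `ψ`. -/
inductive Sub {L : Language} {α : Type*} : Fml L α → Fml L α → Prop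
  | refl (φ : Fml L α) : Sub φ φ
  | impLeft {φ : Fml L α} {n : ℕ} (f g : L.BoundedFormula α n) :
      Sub φ ⟨n, f⟩ → Sub φ ⟨n, f.imp g⟩
  | impRight {φ : Fml L α} {n : ℕ} (f g : L.BoundedFormula α n) :
      Sub φ ⟨n, g⟩ → Sub φ ⟨n, f.imp g⟩
  | allOf {φ : Fml L α} {n : ℕ} (f : L.BoundedFormula α (n + 1)) :
      Sub φ ⟨n + 1, f⟩ → Sub φ ⟨n, f.all⟩

/-- Membership in the subformula closure of a class `Φ` of formulas. -/
def InCl (Φ : Set (Fml L α)) (φ : Fml L α) : Prop := ∃ ψ ∈ Φ, Sub φ ψ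

variable (M : Type*) [L.Structure M]

/-- `IsSatRel M Φ T` says that `T` is a `Φ`-satisfaction relation for the structure `M`:
a relation on pairs consisting of a subformula of a member of `Φ` and an assignment,
satisfying the usual Tarskian recursion clauses. -/
def IsSatRel (Φ : Set (Fml L α))
    (T : ∀ n, L.BoundedFormula α n → (α → M) → (Fin n → M) → Prop) : Prop :=
  (∀ (n : ℕ) (v : α → M) (xs : Fin n → M), InCl Φ ⟨n, BoundedFormula.falsum⟩ →
      ¬ T n BoundedFormula.falsum v xs) ∧
  (∀ (n : ℕ) (t₁ t₂ : L.Term (α ⊕ Fin n)) (v : α → M) (xs : Fin n → M),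
      InCl Φ ⟨n, t₁.bdEqual t₂⟩ →
      (T n (t₁.bdEqual t₂) v xs ↔ t₁.realize (Sum.elim v xs) = t₂.realize (Sum.elim v xs))) ∧
  (∀ (n l : ℕ) (R : L.Relations l) (ts : Fin l → L.Term (α ⊕ Fin n)) (v : α → M)
      (xs : Fin n → M), InCl Φ ⟨n, BoundedFormula.rel R ts⟩ →
      (T n (BoundedFormula.rel R ts) v xs ↔
        Structure.RelMap R fun i => (ts i).realize (Sum.elim v xs))) ∧
  (∀ (n : ℕ) (f g : L.BoundedFormula α n) (v : α → M) (xs : Fin n → M),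
      InCl Φ ⟨n, f.imp g⟩ → (T n (f.imp g) v xs ↔ (T n f v xs → T n g v xs))) ∧
  (∀ (n : ℕ) (f : L.BoundedFormula α (n + 1)) (v : α → M) (xs : Fin n → M),
      InCl Φ ⟨n, f.all⟩ → (T n f.all v xs ↔ ∀ x : M, T (n + 1) f v (Fin.snoc xs x)))

end PaperSat

namespace PaperLK

open FirstOrder FirstOrder.Language

variable {L : Language}

/-- Instantiation of the bound variable of a formula with one extra bound variable
by a term with free variables in `ℕ`. -/
def inst1 (f : L.BoundedFormula ℕ 1) (t : L.Term ℕ) : L.Formula ℕ :=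
  f.toFormula.subst (Sum.elim Term.var fun _ => t)

/-- The equality formula between two terms, as a formula with free variables in `ℕ`. -/
def eqT (t u : L.Term ℕ) : L.Formula ℕ :=
  (t.relabel Sum.inl).bdEqual (u.relabel Sum.inl)

/-- Gentzen's sequent calculus `LK` for classical first-order logic, on sequents of formulas
with free variables in `ℕ`.  The boolean parameter `cut` controls whether the cut rule is
available (`LK false eq` is the cut-free calculus `LK⁻`), and the boolean parameter `eq`
controls whether the rules for the identity predicate are available (`eq = false` gives logic
without identity). -/
inductive LK (cut eq : Bool) : List (L.Formula ℕ) → List (L.Formula ℕ) → Prop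
  | ax (φ : L.Formula ℕ) : LK cut eq [φ] [φ]
  | falsumL : LK cut eq [⊥] []
  | wL {Γ Δ} (φ) : LK cut eq Γ Δ → LK cut eq (φ :: Γ) Δ
  | wR {Γ Δ} (φ) : LK cut eq Γ Δ → LK cut eq Γ (Δ ++ [φ])
  | cL {Γ Δ} {φ} : LK cut eq (φ :: φ :: Γ) Δ → LK cut eq (φ :: Γ) Δ
  | cR {Γ Δ} {φ} : LK cut eq Γ (Δ ++ [φ, φ]) → LK cut eq Γ (Δ ++ [φ])
  | eL {Γ₁ Γ₂ Δ} {φ ψ} : LK cut eq (Γ₁ ++ φ :: ψ :: Γ₂) Δ → LK cut eq (Γ₁ ++ ψ :: φ :: Γ₂) Δ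
  | eR {Γ Δ₁ Δ₂} {φ ψ} : LK cut eq Γ (Δ₁ ++ φ :: ψ :: Δ₂) → LK cut eq Γ (Δ₁ ++ ψ :: φ :: Δ₂)
  | impL {Γ Γ' Δ Δ'} {f g : L.Formula ℕ} :
      LK cut eq Γ (Δ ++ [f]) → LK cut eq (g :: Γ') Δ' →
      LK cut eq ((f.imp g) :: (Γ ++ Γ')) (Δ ++ Δ')
  | impR {Γ Δ} {f g : L.Formula ℕ} :
      LK cut eq (f :: Γ) (Δ ++ [g]) → LK cut eq Γ (Δ ++ [f.imp g])
  | allL {Γ Δ} {f : L.BoundedFormula ℕ 1} (t : L.Term ℕ) :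
      LK cut eq ((inst1 f t) :: Γ) Δ → LK cut eq ((BoundedFormula.all f) :: Γ) Δ
  | allR {Γ Δ} {f : L.BoundedFormula ℕ 1} (k : ℕ)
      (hfresh : ∀ ψ ∈ (BoundedFormula.all f) :: (Γ ++ Δ), k ∉ ψ.freeVarFinset) :
      LK cut eq Γ (Δ ++ [inst1 f (Term.var k)]) →
      LK cut eq Γ (Δ ++ [BoundedFormula.all f])
  | cut' {Γ Γ' Δ Δ'} {φ : L.Formula ℕ} (hc : cut = true) :
      LK cut eq Γ (Δ ++ [φ]) → LK cut eq (φ :: Γ') Δ' → LK cut eq (Γ ++ Γ') (Δ ++ Δ')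
  | eqRefl (he : eq = true) (t : L.Term ℕ) : LK cut eq [] [eqT t t]
  | eqSubst {Γ Δ} {f : L.BoundedFormula ℕ 1} (he : eq = true) (t u : L.Term ℕ) :
      LK cut eq Γ (Δ ++ [inst1 f t]) → LK cut eq ((eqT t u) :: Γ) (Δ ++ [inst1 f u])

/-- Provability of a formula from a theory (a class of formulas), via the full sequent
calculus (with cut and with the rules for identity). -/
def ThmOf (Θ : Set (L.Formula ℕ)) (σ : L.Formula ℕ) : Prop :=
  ∃ Γ : List (L.Formula ℕ), (∀ γ ∈ Γ, γ ∈ Θ) ∧ LK true true Γ [σ]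

/-- A formula is a sentence if it has no free variables. -/
def ClosedF (φ : L.Formula ℕ) : Prop := φ.freeVarFinset = ∅

/-- A theory is consistent if there is no sentence such that both it and its negation
are provable. -/
def ConsistentT (Θ : Set (L.Formula ℕ)) : Prop :=
  ¬ ∃ σ : L.Formula ℕ, ClosedF σ ∧ ThmOf Θ σ ∧ ThmOf Θ σ.not

/-- The class of formulas not containing the identity predicate. -/
inductive EqFree : ∀ {n : ℕ}, L.BoundedFormula ℕ n → Prop
  | falsum {n} : EqFree (n := n) BoundedFormula.falsum
  | rel {n l} (R : L.Relations l) (ts : Fin l → L.Term (ℕ ⊕ Fin n)) :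
      EqFree (BoundedFormula.rel R ts)
  | imp {n} {f g : L.BoundedFormula ℕ n} : EqFree f → EqFree g → EqFree (f.imp g)
  | all {n} {f : L.BoundedFormula ℕ (n + 1)} : EqFree f → EqFree (BoundedFormula.all f)

end PaperLK

namespace PaperSat

open FirstOrder FirstOrder.Language PaperLK

variable {L : Language}

/-- The universal satisfaction predicate `M ⊨* φ` for a structure `M` (possibly a proper
class) and a formula `φ`: every `{φ}`-satisfaction relation for `M` satisfies `φ` (at every
assignment of its variables). -/
def ModelsStarF (M : Type*) [L.Structure M] (φ : L.Formula ℕ) : Prop :=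
  ∀ T, IsSatRel M {(⟨0, φ⟩ : Fml L ℕ)} T → ∀ (v : ℕ → M) (xs : Fin 0 → M), T 0 φ v xs

/-- `M ⊨* Θ` for a theory `Θ`: `M ⊨* φ` for every member `φ` of `Θ`. -/
def ModelsStarT (M : Type*) [L.Structure M] (Θ : Set (L.Formula ℕ)) : Prop :=
  ∀ φ ∈ Θ, ModelsStarF M φ

/-- A structure is weakly satisfactory if for every formula `φ` there exists a
`{φ}`-satisfaction relation for it. -/
def WeaklySatisfactory (M : Type*) [L.Structure M] : Prop :=
  ∀ φ : Fml L ℕ, ∃ T, IsSatRel M {φ} T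

end PaperSat

namespace PaperSat

open PaperLK

/-- Realization of terms depends only on the variables occurring in the term. -/
theorem term_realize_congr {L : Language} {M : Type*} [L.Structure M] {α : Type*} [DecidableEq α]
    {n : ℕ} (t : L.Term (α ⊕ Fin n)) (v w : α → M) (xs : Fin n → M)
    (h : ∀ i ∈ t.varFinsetLeft, v i = w i) :
    t.realize (Sum.elim v xs) = t.realize (Sum.elim w xs) := by
  induction t with
  | var i =>
    cases i with
    | inl i => simpa [Term.varFinsetLeft] using h i (by simp [Term.varFinsetLeft])
    | inr i => rfl
  | func f ts ih =>
    simp only [Term.realize]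
    congr 1
    funext i
    exact ih i fun j hj => h j (by
      simp only [Term.varFinsetLeft, Finset.mem_biUnion, Finset.mem_univ, true_and]
      exact ⟨i, hj⟩)

/-- Realization of formulas depends only on the free variables. -/
theorem realize_congr {L : Language} {M : Type*} [L.Structure M] {α : Type*} [DecidableEq α]
    {n : ℕ} (f : L.BoundedFormula α n) (v w : α → M) (xs : Fin n → M)
    (h : ∀ i ∈ f.freeVarFinset, v i = w i) :
    f.Realize v xs ↔ f.Realize w xs := by
  induction f with
  | falsum => rfl
  | equal t u =>
    simp only [BoundedFormula.freeVarFinset, Finset.mem_union] at h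
    simp only [BoundedFormula.Realize]
    rw [term_realize_congr t v w xs fun i hi => h i (Or.inl hi),
      term_realize_congr u v w xs fun i hi => h i (Or.inr hi)]
  | rel R ts =>
    simp only [BoundedFormula.Realize]
    have : ∀ i, (ts i).realize (Sum.elim v xs) = (ts i).realize (Sum.elim w xs) := fun i =>
      term_realize_congr (ts i) v w xs fun j hj => h j (by
        simp only [BoundedFormula.freeVarFinset, Finset.mem_biUnion, Finset.mem_univ, true_and]
        exact ⟨i, hj⟩)
    simp only [this]
  | imp f g ihf ihg =>
    simp only [BoundedFormula.freeVarFinset, Finset.mem_union] at h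
    simp only [BoundedFormula.Realize]
    rw [ihf xs fun i hi => h i (Or.inl hi), ihg xs fun i hi => h i (Or.inr hi)]
  | all f ih =>
    simp only [BoundedFormula.Realize]
    exact forall_congr' fun x => ih _ h

/-- The Tarskian satisfaction relation is a satisfaction relation. -/
theorem isSatRel_realize {L : Language} {α : Type*} (M : Type*) [L.Structure M]
    (Φ : Set (Fml L α)) : IsSatRel M Φ fun _ f v xs => f.Realize v xs :=
  ⟨fun _ _ _ _ h => h, fun _ _ _ _ _ _ => Iff.rfl, fun _ _ _ _ _ _ _ => Iff.rfl,
    fun _ _ _ _ _ _ => Iff.rfl, fun _ _ _ _ _ => Iff.rfl⟩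

theorem Sub.trans' {L : Language} {α : Type*} {a b c : Fml L α} (h : Sub a b) (h' : Sub b c) :
    Sub a c := by
  induction h' with
  | refl => exact h
  | impLeft f g _ ih => exact .impLeft f g ih
  | impRight f g _ ih => exact .impRight f g ih
  | allOf f _ ih => exact .allOf f ih

/-- Any satisfaction relation agrees with realization on its domain. -/
theorem satRel_iff {L : Language} {α : Type*} {M : Type*} [L.Structure M]
    {Φ : Set (Fml L α)} {T} (hT : IsSatRel M Φ T) {n : ℕ} (f : L.BoundedFormula α n)
    (hf : InCl Φ ⟨n, f⟩) (v : α → M) (xs : Fin n → M) : T n f v xs ↔ f.Realize v xs := by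
  obtain ⟨h1, h2, h3, h4, h5⟩ := hT
  induction f with
  | falsum => exact iff_of_false (h1 _ v xs hf) id
  | equal t u => exact h2 _ t u v xs hf
  | rel R ts => exact h3 _ _ R ts v xs hf
  | imp f g ihf ihg =>
    obtain ⟨ψ, hψ, hs⟩ := id hf
    rw [h4 _ f g v xs hf, ihf ⟨ψ, hψ, (Sub.impLeft f g (.refl _)).trans' hs⟩,
      ihg ⟨ψ, hψ, (Sub.impRight f g (.refl _)).trans' hs⟩]
    rfl
  | all f ih =>
    obtain ⟨ψ, hψ, hs⟩ := id hf
    rw [h5 _ f v xs hf]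
    exact forall_congr' fun x => ih ⟨ψ, hψ, (Sub.allOf f (.refl _)).trans' hs⟩ _

theorem modelsStarF_iff {L : Language} (M : Type*) [L.Structure M] (φ : L.Formula ℕ) :
    ModelsStarF M φ ↔ ∀ v : ℕ → M, φ.Realize v := by
  constructor
  · intro h v
    exact h _ (isSatRel_realize M _) v default
  · intro h T hT v xs
    rw [satRel_iff hT φ ⟨_, rfl, .refl _⟩, Subsingleton.elim xs default]
    exact h v

theorem realize_inst1 {L : Language} {M : Type*} [L.Structure M] (f : L.BoundedFormula ℕ 1)
    (t : L.Term ℕ) (v : ℕ → M) :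
    (inst1 f t).Realize v ↔ f.Realize v (Fin.snoc default (t.realize v)) := by
  unfold inst1 Formula.Realize
  rw [BoundedFormula.realize_subst]
  change f.toFormula.Realize _ ↔ _
  rw [BoundedFormula.realize_toFormula]
  have h1 : ((fun a => Term.realize v ((Sum.elim Term.var fun _ => t : ℕ ⊕ Fin 1 → L.Term ℕ) a)) ∘
      Sum.inl) = v := by funext i; rfl
  have h2 : ((fun a => Term.realize v ((Sum.elim Term.var fun _ => t : ℕ ⊕ Fin 1 → L.Term ℕ) a)) ∘
      Sum.inr) = (Fin.snoc default (t.realize v) : Fin 1 → M) := by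
    funext i
    rw [Subsingleton.elim i (Fin.last 0), Fin.snoc_last]
    rfl
  rw [h1, h2]

theorem realize_all1 {L : Language} {M : Type*} [L.Structure M] (f : L.BoundedFormula ℕ 1)
    (v : ℕ → M) :
    Formula.Realize (BoundedFormula.all f : L.Formula ℕ) v ↔
      ∀ x : M, f.Realize v (Fin.snoc default x) := Iff.rfl

theorem realize_imp0 {L : Language} {M : Type*} [L.Structure M] (f g : L.Formula ℕ)
    (v : ℕ → M) :
    Formula.Realize (BoundedFormula.imp f g : L.Formula ℕ) v ↔ (f.Realize v → g.Realize v) :=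
  Iff.rfl

theorem realize_eqT {L : Language} {M : Type*} [L.Structure M] (t u : L.Term ℕ)
    (v : ℕ → M) : (eqT t u).Realize v ↔ t.realize v = u.realize v := by
  unfold eqT Formula.Realize
  simp [BoundedFormula.realize_bdEqual, Term.realize_relabel]

/-- Soundness of the sequent calculus. -/
theorem LK_sound {L : Language} {M : Type*} [L.Structure M] {c e : Bool}
    {Γ Δ : List (L.Formula ℕ)} (h : LK c e Γ Δ) (v : ℕ → M)
    (hΓ : ∀ γ ∈ Γ, γ.Realize v) : ∃ δ ∈ Δ, δ.Realize v := by
  induction h generalizing v with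
  | ax φ => exact ⟨φ, by simp, hΓ φ (by simp)⟩
  | falsumL => exact (hΓ ⊥ (by simp)).elim
  | wL φ _ ih => exact ih v fun γ hγ => hΓ γ (by simp [hγ])
  | wR φ _ ih =>
    obtain ⟨δ, h1, h2⟩ := ih v hΓ
    exact ⟨δ, by simp [h1], h2⟩
  | cL _ ih => exact ih v fun γ hγ => hΓ γ (by simpa using hγ)
  | cR _ ih =>
    obtain ⟨δ, h1, h2⟩ := ih v hΓ
    exact ⟨δ, by simpa using h1, h2⟩
  | eL _ ih =>
    refine ih v fun γ hγ => hΓ γ ?_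
    simp only [List.mem_append, List.mem_cons] at hγ ⊢
    tauto
  | eR _ ih =>
    obtain ⟨δ, h1, h2⟩ := ih v hΓ
    refine ⟨δ, ?_, h2⟩
    simp only [List.mem_append, List.mem_cons] at h1 ⊢
    tauto
  | @impL Γ Γ' Δ Δ' f g _ _ ih1 ih2 =>
    obtain ⟨δ, h1, h2⟩ := ih1 v fun γ hγ => hΓ γ (by simp [hγ])
    simp only [List.mem_append, List.mem_singleton] at h1
    rcases h1 with h1 | rfl
    · exact ⟨δ, by simp [h1], h2⟩
    · have hg : g.Realize v := (realize_imp0 _ _ v).1 (hΓ (BoundedFormula.imp δ g) (by simp)) h2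
      obtain ⟨δ', h3, h4⟩ := ih2 v (by
        intro γ hγ
        rcases List.mem_cons.1 hγ with rfl | hγ
        · exact hg
        · exact hΓ γ (by simp [hγ]))
      exact ⟨δ', by simp [h3], h4⟩
  | @impR Γ Δ f g _ ih =>
    by_cases hf : f.Realize v
    · obtain ⟨δ, h1, h2⟩ := ih v (by
        intro γ hγ
        rcases List.mem_cons.1 hγ with rfl | hγ
        · exact hf
        · exact hΓ γ hγ)
      simp only [List.mem_append, List.mem_singleton] at h1
      rcases h1 with h1 | rfl
      · exact ⟨δ, by simp [h1], h2⟩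
      · exact ⟨BoundedFormula.imp f δ, by simp, (realize_imp0 _ _ v).2 fun _ => h2⟩
    · exact ⟨BoundedFormula.imp f g, by simp, (realize_imp0 _ _ v).2 fun h => (hf h).elim⟩
  | @allL Γ Δ f t _ ih =>
    refine ih v ?_
    intro γ hγ
    rcases List.mem_cons.1 hγ with rfl | hγ
    · rw [realize_inst1]
      exact (realize_all1 f v).1 (hΓ (BoundedFormula.all f) (by simp)) _
    · exact hΓ γ (by simp [hγ])
  | @allR Γ Δ f k hfresh _ ih =>
    by_contra hcon
    push Not at hcon
    refine hcon (BoundedFormula.all f) (by simp) ((realize_all1 f v).2 fun x => ?_)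
    have key : ∀ ψ ∈ (BoundedFormula.all f) :: (Γ ++ Δ), ∀ i ∈ ψ.freeVarFinset,
        Function.update v k x i = v i := by
      intro ψ hψ i hi
      apply Function.update_of_ne
      rintro rfl
      exact hfresh ψ hψ hi
    obtain ⟨δ, h1, h2⟩ := ih (Function.update v k x) fun γ hγ =>
      (realize_congr γ _ v _ (key γ (by simp [hγ]))).2 (hΓ γ hγ)
    simp only [List.mem_append, List.mem_singleton] at h1
    rcases h1 with h1 | rfl
    · exact (hcon δ (by simp [h1])
        ((realize_congr δ _ v _ (key δ (by simp [h1]))).1 h2)).elim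
    · rw [realize_inst1] at h2
      have h3 := (realize_congr f _ v _ (key (BoundedFormula.all f) (by simp))).1 h2
      simpa using h3
  | @cut' Γ Γ' Δ Δ' φ _ _ _ ih1 ih2 =>
    obtain ⟨δ, h1, h2⟩ := ih1 v fun γ hγ => hΓ γ (by simp [hγ])
    simp only [List.mem_append, List.mem_singleton] at h1
    rcases h1 with h1 | rfl
    · exact ⟨δ, by simp [h1], h2⟩
    · obtain ⟨δ', h3, h4⟩ := ih2 v (by
        intro γ hγ
        rcases List.mem_cons.1 hγ with rfl | hγ
        · exact h2
        · exact hΓ γ (by simp [hγ]))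
      exact ⟨δ', by simp [h3], h4⟩
  | eqRefl _ t => exact ⟨eqT t t, by simp, (realize_eqT t t v).2 rfl⟩
  | @eqSubst Γ Δ f _ t u _ ih =>
    obtain ⟨δ, h1, h2⟩ := ih v fun γ hγ => hΓ γ (by simp [hγ])
    simp only [List.mem_append, List.mem_singleton] at h1
    rcases h1 with h1 | rfl
    · exact ⟨δ, by simp [h1], h2⟩
    · refine ⟨inst1 f u, by simp, ?_⟩
      have heq := (realize_eqT t u v).1 (hΓ (eqT t u) (by simp))
      rw [realize_inst1] at h2 ⊢
      rwa [← heq]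

/-- Let `M` be a weakly satisfactory structure, `Θ` a theory (of sentences),
and `σ` a sentence.  If `M ⊨* Θ` and `Θ ⊢ σ`, then `M ⊨* σ`. -/
theorem modelsStar_of_provable (L : Language) (M : Type*) [L.Structure M]
    (Θ : Set (L.Formula ℕ)) (σ : L.Formula ℕ)
    (hΘc : ∀ θ ∈ Θ, ClosedF θ) (hσc : ClosedF σ)
    (hws : WeaklySatisfactory (L := L) M) (hsat : ModelsStarT M Θ) (hprov : ThmOf Θ σ) :
    ModelsStarF M σ := by
  obtain ⟨Γ, hΓ, hLK⟩ := hprov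
  rw [modelsStarF_iff]
  intro v
  obtain ⟨δ, h1, h2⟩ := LK_sound hLK v fun γ hγ =>
    (modelsStarF_iff M γ).1 (hsat γ (hΓ γ hγ)) v
  rw [List.mem_singleton] at h1
  exact h1 ▸ h2

end PaperSat
end

section
/- If ZF is consistent, then ZF minus the axiom of infinity plus the negation of infinity (equivalently, first-order Peano arithmetic) is not finitely axiomatizable: there is no single sentence θ provable from this theory that implies all of its axioms. -/
open FirstOrder FirstOrder.Language

namespace PaperZF

open FirstOrder FirstOrder.Language

/-- The relation symbols of the language of set theory: a single binary relation `∈`. -/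
inductive SetRel : ℕ → Type
  | mem : SetRel 2

/-- The language of pure set theory. -/
def setLang : Language := ⟨fun _ => Empty, SetRel⟩

variable {L : Language}

/-- The `i`-th free variable, as a term. -/
def fv (i : ℕ) : L.Term (ℕ ⊕ Fin 0) := Term.var (Sum.inl i)

/-- Atomic membership formula `xᵢ ∈ xⱼ` for a binary relation symbol. -/
def memF (R : L.Relations 2) (i j : ℕ) : L.Formula ℕ := R.boundedFormula₂ (fv i) (fv j)

/-- Atomic equality formula `xᵢ = xⱼ`. -/
def eqF (i j : ℕ) : L.Formula ℕ := Term.bdEqual (fv i : L.Term (ℕ ⊕ Fin 0)) (fv j)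

/-- Atomic formula `P xᵢ` for a unary relation symbol `P`. -/
def prF (P : L.Relations 1) (i : ℕ) : L.Formula ℕ := P.boundedFormula₁ (fv i)

/-- Universal quantification binding the free variable with index `k`. -/
def bA (k : ℕ) (φ : L.Formula ℕ) : L.Formula ℕ :=
  (BoundedFormula.relabel (fun m => if m = k then Sum.inr (0 : Fin 1) else Sum.inl m) φ).all

/-- Existential quantification binding the free variable with index `k`. -/
def bE (k : ℕ) (φ : L.Formula ℕ) : L.Formula ℕ :=
  (BoundedFormula.relabel (fun m => if m = k then Sum.inr (0 : Fin 1) else Sum.inl m) φ).ex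

/-- An index not occurring free in `φ` (and larger than any free index of `φ`). -/
def freshIdx (φ : L.Formula ℕ) : ℕ := (φ.freeVarFinset.sup id) + 1

section ZFAxioms

variable (R : L.Relations 2)

/-- Extensionality. -/
def extAx : L.Formula ℕ :=
  bA 0 (bA 1 ((bA 2 ((memF R 2 0).iff (memF R 2 1))).imp (eqF 0 1)))

/-- Pairing. -/
def pairAx : L.Formula ℕ :=
  bA 0 (bA 1 (bE 2 (bA 3 ((memF R 3 2).iff ((eqF 3 0) ⊔ (eqF 3 1))))))

/-- Union. -/
def unionAx : L.Formula ℕ :=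
  bA 0 (bE 1 (bA 2 ((memF R 2 1).iff (bE 3 ((memF R 2 3) ⊓ (memF R 3 0))))))

/-- Power set. -/
def powerAx : L.Formula ℕ :=
  bA 0 (bE 1 (bA 2 ((memF R 2 1).iff (bA 3 ((memF R 3 2).imp (memF R 3 0))))))

/-- Infinity. -/
def inftyAx : L.Formula ℕ :=
  bE 0 ((bE 1 ((memF R 1 0) ⊓ (bA 2 (BoundedFormula.not (memF R 2 1))))) ⊓
    (bA 1 ((memF R 1 0).imp
      (bE 2 ((memF R 2 0) ⊓ (bA 3 ((memF R 3 2).iff ((memF R 3 1) ⊔ (eqF 3 1)))))))))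

/-- Foundation. -/
def foundAx : L.Formula ℕ :=
  bA 0 ((bE 1 (memF R 1 0)).imp
    (bE 1 ((memF R 1 0) ⊓ (bA 2 ((memF R 2 1).imp (BoundedFormula.not (memF R 2 0)))))))

/-- An instance of the Separation (Comprehension) schema, for the formula `φ` whose
distinguished variable is the free variable `0`; the other free variables of `φ` act as
parameters. -/
def sepAx (φ : L.Formula ℕ) : L.Formula ℕ :=
  let a := freshIdx φ + 2
  let b := a + 1
  bA a (bE b (bA 0 ((memF R 0 b).iff ((memF R 0 a) ⊓ φ))))

/-- An instance of the Collection schema, for the formula `φ` whose distinguished variables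
are the free variables `0` and `1`; the other free variables of `φ` act as parameters. -/
def collAx (φ : L.Formula ℕ) : L.Formula ℕ :=
  let a := freshIdx φ + 2
  let b := a + 1
  bA a ((bA 0 ((memF R 0 a).imp (bE 1 φ))).imp
    (bE b (bA 0 ((memF R 0 a).imp (bE 1 ((memF R 1 b) ⊓ φ))))))

/-- The theory `S`: `ZF` with the axiom of infinity omitted, over the membership relation
symbol `R` of the language `L`. -/
def sTheoryOf : Set (L.Formula ℕ) :=
  {extAx R, pairAx R, unionAx R, powerAx R, foundAx R} ∪
    {ψ | ∃ φ, ψ = sepAx R φ} ∪ {ψ | ∃ φ, ψ = collAx R φ}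

/-- The theory `ZF`, over the membership relation symbol `R` of the language `L`. -/
def zfTheoryOf : Set (L.Formula ℕ) := sTheoryOf R ∪ {inftyAx R}

end ZFAxioms

/-- The theory `S` (`ZF` minus infinity) in the language of pure set theory. -/
def Sthy : Set (setLang.Formula ℕ) := sTheoryOf SetRel.mem

/-- The theory `ZF` in the language of pure set theory. -/
def ZFthy : Set (setLang.Formula ℕ) := zfTheoryOf SetRel.mem

/-- The theory `F = S + ¬Infinity`. -/
def Fthy : Set (setLang.Formula ℕ) := Sthy ∪ {BoundedFormula.not (inftyAx SetRel.mem)}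

end PaperZF

namespace PaperZF

open PaperLK

section Helpers

/-- Realization of a formula only depends on the values of its free variables. -/
theorem realize_congr_free {L : Language} {S : Type*} [L.Structure S] {n : ℕ}
    (φ : L.BoundedFormula ℕ n) (v w : ℕ → S) (xs : Fin n → S)
    (h : ∀ k ∈ φ.freeVarFinset, v k = w k) : φ.Realize v xs ↔ φ.Realize w xs := by
  have h1 := BoundedFormula.realize_restrictFreeVar (φ := φ)
    (f := fun x : φ.freeVarFinset => (x : ℕ)) (v := v) (v' := v) (xs := xs) (fun a => rfl)
  have h2 := BoundedFormula.realize_restrictFreeVar (φ := φ)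
    (f := fun x : φ.freeVarFinset => (x : ℕ)) (v := v) (v' := w) (xs := xs) (fun a => h _ a.2)
  exact h1.symm.trans h2

theorem realize_inst1 {L : Language} {S : Type*} [L.Structure S]
    (f : L.BoundedFormula ℕ 1) (t : L.Term ℕ) (v : ℕ → S) :
    (inst1 f t).Realize v ↔ f.Realize v (Fin.snoc default (t.realize v)) := by
  unfold inst1 Formula.Realize
  rw [BoundedFormula.realize_subst]
  have := BoundedFormula.realize_toFormula f
    (fun a => Term.realize v (Sum.elim Term.var (fun _ => t) a))
  unfold Formula.Realize at this
  rw [this]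
  apply iff_of_eq
  congr 1

theorem realize_all_formula {L : Language} {S : Type*} [L.Structure S]
    (f : L.BoundedFormula ℕ 1) (v : ℕ → S) :
    Formula.Realize (BoundedFormula.all f) v ↔
      ∀ x, f.Realize v (Fin.snoc default x) := by
  unfold Formula.Realize
  exact BoundedFormula.realize_all

theorem realize_eqT {L : Language} {S : Type*} [L.Structure S] (t u : L.Term ℕ) (v : ℕ → S) :
    (eqT t u).Realize v ↔ t.realize v = u.realize v := by
  unfold eqT Formula.Realize
  simp [Term.realize_relabel, Function.comp_def]

/-- Soundness of the sequent calculus. -/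
theorem LK_sound {L : Language} {S : Type*} [L.Structure S] {c e : Bool}
    {Γ Δ : List (L.Formula ℕ)} (h : LK c e Γ Δ) :
    ∀ v : ℕ → S, (∀ γ ∈ Γ, γ.Realize v) → ∃ δ ∈ Δ, δ.Realize v := by
  induction h with
  | ax φ => intro v h; exact ⟨φ, by simp, h φ (by simp)⟩
  | falsumL => intro v h; exact absurd (h ⊥ (by simp)) (by simp)
  | wL φ _ ih => intro v h; exact ih v fun γ hγ => h γ (by simp [hγ])
  | wR φ _ ih =>
    intro v h
    obtain ⟨δ, hδ, hr⟩ := ih v h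
    exact ⟨δ, by simp [hδ], hr⟩
  | cL _ ih => intro v h; exact ih v fun γ hγ => h γ (by simpa using hγ)
  | cR _ ih =>
    intro v h
    obtain ⟨δ, hδ, hr⟩ := ih v h
    exact ⟨δ, by simpa using hδ, hr⟩
  | eL _ ih =>
    intro v h
    refine ih v fun γ hγ => h γ ?_
    simp only [List.mem_append, List.mem_cons] at hγ ⊢
    tauto
  | eR _ ih =>
    intro v h
    obtain ⟨δ, hδ, hr⟩ := ih v h
    refine ⟨δ, ?_, hr⟩
    simp only [List.mem_append, List.mem_cons] at hδ ⊢
    tauto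
  | @impL Γ Γ' Δ Δ' f g _ _ ih1 ih2 =>
    intro v h
    obtain ⟨δ, hδ, hr⟩ := ih1 v fun γ hγ => h γ (by simp [hγ])
    rw [List.mem_append, List.mem_singleton] at hδ
    rcases hδ with hδ | rfl
    · exact ⟨δ, by simp [hδ], hr⟩
    · have hi : Formula.Realize (δ.imp g) v := h _ (by simp)
      rw [Formula.realize_imp] at hi
      obtain ⟨δ', hδ', hr'⟩ := ih2 v (by
        intro γ hγ
        rcases List.mem_cons.1 hγ with rfl | hγ
        · exact hi hr
        · exact h γ (by simp [hγ]))
      exact ⟨δ', by simp [hδ'], hr'⟩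
  | @impR Γ Δ f g _ ih =>
    intro v h
    by_cases hf : f.Realize v
    · obtain ⟨δ, hδ, hr⟩ := ih v (by
        intro γ hγ
        rcases List.mem_cons.1 hγ with rfl | hγ
        · exact hf
        · exact h γ hγ)
      rw [List.mem_append, List.mem_singleton] at hδ
      rcases hδ with hδ | rfl
      · exact ⟨δ, by simp [hδ], hr⟩
      · exact ⟨f.imp δ, by simp, Formula.realize_imp.2 fun _ => hr⟩
    · exact ⟨f.imp g, by simp, Formula.realize_imp.2 fun h => absurd h hf⟩
  | @allL Γ Δ f t _ ih =>
    intro v h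
    refine ih v ?_
    intro γ hγ
    rcases List.mem_cons.1 hγ with rfl | hγ
    · exact (realize_inst1 f t v).2 ((realize_all_formula f v).1 (h _ (by simp)) _)
    · exact h γ (by simp [hγ])
  | @allR Γ Δ f k hfresh _ ih =>
    intro v h
    by_contra hcon
    push Not at hcon
    have hall : ¬ Formula.Realize (BoundedFormula.all f) v := hcon _ (by simp)
    rw [realize_all_formula] at hall
    push Not at hall
    obtain ⟨x, hx⟩ := hall
    have key : ∀ ψ : L.Formula ℕ, k ∉ ψ.freeVarFinset →
        (ψ.Realize (Function.update v k x) ↔ ψ.Realize v) := by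
      intro ψ hψ
      refine realize_congr_free ψ _ _ _ fun j hj => ?_
      rw [Function.update_of_ne]
      rintro rfl
      exact hψ hj
    obtain ⟨δ, hδ, hr⟩ := ih (Function.update v k x) (by
      intro γ hγ
      exact (key γ (hfresh γ (by simp [hγ]))).2 (h γ hγ))
    rw [List.mem_append, List.mem_singleton] at hδ
    rcases hδ with hδ | rfl
    · exact hcon δ (by simp [hδ]) ((key δ (hfresh δ (by simp [hδ]))).1 hr)
    · rw [realize_inst1] at hr
      have hk : k ∉ f.freeVarFinset := hfresh (BoundedFormula.all f) (by simp)
      simp only [Term.realize_var, Function.update_self] at hr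
      refine hx ((realize_congr_free f _ _ _ fun j hj => ?_).1 hr)
      rw [Function.update_of_ne]
      rintro rfl
      exact hk hj
  | cut' _ _ _ ih1 ih2 =>
    intro v h
    obtain ⟨δ, hδ, hr⟩ := ih1 v fun γ hγ => h γ (by simp [hγ])
    rw [List.mem_append, List.mem_singleton] at hδ
    rcases hδ with hδ | rfl
    · exact ⟨δ, by simp [hδ], hr⟩
    · obtain ⟨δ', hδ', hr'⟩ := ih2 v (by
        intro γ hγ
        rcases List.mem_cons.1 hγ with rfl | hγ
        · exact hr
        · exact h γ (by simp [hγ]))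
      exact ⟨δ', by simp [hδ'], hr'⟩
  | eqRefl _ t => intro v h; exact ⟨_, by simp, (realize_eqT t t v).2 rfl⟩
  | @eqSubst Γ Δ f _ t u _ ih =>
    intro v h
    obtain ⟨δ, hδ, hr⟩ := ih v fun γ hγ => h γ (by simp [hγ])
    rw [List.mem_append, List.mem_singleton] at hδ
    rcases hδ with hδ | rfl
    · exact ⟨δ, by simp [hδ], hr⟩
    · have he := (realize_eqT t u v).1 (h _ (by simp))
      refine ⟨_, List.mem_append.2 (Or.inr (List.mem_singleton.2 rfl)), ?_⟩
      rw [realize_inst1] at hr ⊢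
      rwa [← he]

theorem thm_sound {L : Language} {S : Type*} [L.Structure S] {Θ : Set (L.Formula ℕ)}
    {σ : L.Formula ℕ} (h : ThmOf Θ σ) (v : ℕ → S) (hΘ : ∀ γ ∈ Θ, γ.Realize v) :
    σ.Realize v := by
  obtain ⟨Γ, hΓ, hd⟩ := h
  obtain ⟨δ, hδ, hr⟩ := LK_sound hd v fun γ hγ => hΘ γ (hΓ γ hγ)
  rw [List.mem_singleton] at hδ
  exact hδ ▸ hr

/-- The membership relation of a structure for the language of set theory. -/
def E {S : Type} [setLang.Structure S] (x y : S) : Prop :=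
  Structure.RelMap (L := setLang) (n := 2) SetRel.mem ![x, y]

section Sem
variable {S : Type} [setLang.Structure S] (v : ℕ → S)

theorem sat_memF_gen {L : Language} {S : Type} [L.Structure S] (v : ℕ → S)
    (R : L.Relations 2) (i j : ℕ) :
    Formula.Realize (memF R i j) v ↔ Structure.RelMap R ![v i, v j] := by
  unfold memF Formula.Realize
  rw [BoundedFormula.realize_rel₂]
  simp [fv]

theorem sat_memF (i j : ℕ) :
    Formula.Realize (memF (L := setLang) SetRel.mem i j) v ↔ E (v i) (v j) :=
  sat_memF_gen v _ i j

theorem sat_eqF (i j : ℕ) :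
    Formula.Realize (eqF (L := setLang) i j) v ↔ v i = v j := by
  unfold eqF Formula.Realize
  rw [BoundedFormula.realize_bdEqual]
  simp [fv]

theorem relabel_aux (k : ℕ) (φ : setLang.Formula ℕ) (x : S) :
    (BoundedFormula.relabel (fun m => if m = k then Sum.inr (0 : Fin 1) else Sum.inl m) φ).Realize
      v (Fin.snoc default x : Fin 1 → S) ↔ φ.Realize (Function.update v k x) := by
  have := BoundedFormula.realize_relabel (φ := φ)
    (g := fun m => if m = k then Sum.inr (0 : Fin 1) else Sum.inl m) (v := v)
    (xs := (Fin.snoc default x : Fin 1 → S))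
  refine this.trans ?_
  unfold Formula.Realize
  apply iff_of_eq
  congr 1
  · funext m
    by_cases h : m = k
    · subst h; simp [Fin.snoc]
    · simp [h]
  · exact Subsingleton.elim _ _

theorem sat_bA (k : ℕ) (φ : setLang.Formula ℕ) :
    Formula.Realize (bA k φ) v ↔ ∀ x, φ.Realize (Function.update v k x) := by
  unfold bA
  rw [realize_all_formula]
  exact forall_congr' fun x => relabel_aux v k φ x

theorem sat_bE (k : ℕ) (φ : setLang.Formula ℕ) :
    Formula.Realize (bE k φ) v ↔ ∃ x, φ.Realize (Function.update v k x) := by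
  unfold bE
  have : ∀ f : setLang.BoundedFormula ℕ 1, Formula.Realize f.ex v ↔
      ∃ x, f.Realize v (Fin.snoc default x) := fun f => by
    unfold Formula.Realize; exact BoundedFormula.realize_ex
  rw [this]
  exact exists_congr fun x => relabel_aux v k φ x

theorem sat_fresh (φ : setLang.Formula ℕ) (k : ℕ) (hk : freshIdx φ ≤ k) (x : S) :
    φ.Realize (Function.update v k x) ↔ φ.Realize v := by
  refine realize_congr_free φ _ _ _ fun j hj => ?_
  rw [Function.update_of_ne]
  rintro rfl
  have : id j ≤ φ.freeVarFinset.sup id := Finset.le_sup hj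
  unfold freshIdx at hk
  simp only [id] at this
  omega

end Sem

section Axioms
variable {S : Type} [setLang.Structure S] (v : ℕ → S)

theorem sat_ext : Formula.Realize (extAx (L := setLang) SetRel.mem) v ↔
    ∀ x y : S, (∀ z, E z x ↔ E z y) → x = y := by
  simp [extAx, sat_bA, sat_memF, sat_eqF, Function.update]

theorem sat_pair : Formula.Realize (pairAx (L := setLang) SetRel.mem) v ↔
    ∀ x y : S, ∃ p, ∀ z, E z p ↔ z = x ∨ z = y := by
  simp [pairAx, sat_bA, sat_bE, sat_memF, sat_eqF, Function.update]

theorem sat_union : Formula.Realize (unionAx (L := setLang) SetRel.mem) v ↔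
    ∀ x : S, ∃ u, ∀ z, E z u ↔ ∃ w, E z w ∧ E w x := by
  simp [unionAx, sat_bA, sat_bE, sat_memF, Function.update]

theorem sat_power : Formula.Realize (powerAx (L := setLang) SetRel.mem) v ↔
    ∀ x : S, ∃ p, ∀ z, E z p ↔ ∀ w, E w z → E w x := by
  simp [powerAx, sat_bA, sat_bE, sat_memF, Function.update]

theorem sat_found : Formula.Realize (foundAx (L := setLang) SetRel.mem) v ↔
    ∀ x : S, (∃ y, E y x) → ∃ y, E y x ∧ ∀ z, E z y → ¬ E z x := by
  simp only [foundAx, sat_bA, sat_bE, sat_memF, Formula.realize_imp, Formula.realize_inf]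
  refine forall_congr' fun x => imp_congr (by simp [Function.update]) ?_
  refine exists_congr fun y => and_congr (by simp [Function.update]) ?_
  refine forall_congr' fun z => imp_congr (by simp [Function.update]) ?_
  refine Formula.realize_not.trans ?_
  simp [sat_memF, Function.update]

theorem sat_infty : Formula.Realize (inftyAx (L := setLang) SetRel.mem) v ↔
    ∃ x : S, (∃ y, E y x ∧ ∀ z, ¬ E z y) ∧
      ∀ y, E y x → ∃ s, E s x ∧ ∀ z, E z s ↔ E z y ∨ z = y := by
  simp only [inftyAx, sat_bA, sat_bE, sat_memF, Formula.realize_imp, Formula.realize_inf]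
  refine exists_congr fun x => and_congr ?_ ?_
  · refine exists_congr fun y => and_congr (by simp [Function.update]) ?_
    refine forall_congr' fun z => ?_
    refine Formula.realize_not.trans ?_
    simp [sat_memF, Function.update]
  · simp [sat_memF, sat_eqF, Function.update]

theorem sat_sep (φ : setLang.Formula ℕ) :
    Formula.Realize (sepAx (L := setLang) SetRel.mem φ) v ↔
    ∀ x : S, ∃ b, ∀ z, E z b ↔ E z x ∧ φ.Realize (Function.update v 0 z) := by
  unfold sepAx
  simp only [sat_bA, sat_bE, Formula.realize_iff, Formula.realize_inf, sat_memF]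
  refine forall_congr' fun x => exists_congr fun b => forall_congr' fun z => ?_
  have h1 : φ.Realize (Function.update (Function.update (Function.update v (freshIdx φ + 2) x)
      (freshIdx φ + 2 + 1) b) 0 z) ↔ φ.Realize (Function.update v 0 z) := by
    rw [Function.update_comm (by omega), sat_fresh _ _ _ (by omega),
      Function.update_comm (by omega), sat_fresh _ _ _ (by omega)]
  rw [h1]
  simp [Function.update]

theorem sat_coll (φ : setLang.Formula ℕ) :
    Formula.Realize (collAx (L := setLang) SetRel.mem φ) v ↔
    ∀ x : S, (∀ z, E z x → ∃ y, φ.Realize (Function.update (Function.update v 0 z) 1 y)) →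
      ∃ b, ∀ z, E z x → ∃ y, E y b ∧
        φ.Realize (Function.update (Function.update v 0 z) 1 y) := by
  unfold collAx
  simp only [sat_bA, sat_bE, Formula.realize_imp, Formula.realize_inf, sat_memF]
  have hf : 1 ≤ freshIdx φ := by unfold freshIdx; omega
  refine forall_congr' fun x => imp_congr ?_ ?_
  · refine forall_congr' fun z => imp_congr (by simp [Function.update]) ?_
    refine exists_congr fun y => ?_
    rw [Function.update_comm (a := freshIdx φ + 2) (b := 0) (by omega),
      Function.update_comm (a := freshIdx φ + 2) (b := 1) (by omega), sat_fresh _ _ _ (by omega)]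
  · refine exists_congr fun b => forall_congr' fun z =>
      imp_congr (by simp [Function.update]) ?_
    refine exists_congr fun y => and_congr (by simp [Function.update]) ?_
    rw [Function.update_comm (a := freshIdx φ + 2 + 1) (b := 0) (by omega),
      Function.update_comm (a := freshIdx φ + 2 + 1) (b := 1) (by omega),
      sat_fresh _ _ _ (by omega),
      Function.update_comm (a := freshIdx φ + 2) (b := 0) (by omega),
      Function.update_comm (a := freshIdx φ + 2) (b := 1) (by omega), sat_fresh _ _ _ (by omega)]

end Axioms

/-- The structure for the language of set theory given by a binary relation. -/
@[reducible] def strOf (S : Type) (R : S → S → Prop) : setLang.Structure S where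
  funMap := fun f => (f : Empty).elim
  RelMap := fun {n} (r : SetRel n) =>
    match n, r with
    | _, SetRel.mem => fun xs => R (xs 0) (xs 1)

theorem E_strOf (S : Type) (R : S → S → Prop) (x y : S) :
    @E S (strOf S R) x y ↔ R x y := Iff.rfl

/-- Ackermann's model of hereditarily finite set theory on the natural numbers. -/
instance natStr : setLang.Structure ℕ := strOf ℕ fun x y => y.testBit x = true

theorem E_nat (x y : ℕ) : E x y ↔ y.testBit x = true := Iff.rfl

theorem E_lt {x y : ℕ} (h : E x y) : x < y :=
  lt_of_lt_of_le Nat.lt_two_pow_self (Nat.ge_two_pow_of_testBit h)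

theorem nat_ext {x y : ℕ} (h : ∀ z, E z x ↔ E z y) : x = y := by
  refine Nat.eq_of_testBit_eq fun i => ?_
  have := h i
  rw [E_nat, E_nat] at this
  exact Bool.eq_iff_iff.2 this

theorem nat_set {s : Set ℕ} (hs : s.Finite) : ∃ b : ℕ, ∀ z, E z b ↔ z ∈ s := by
  refine ⟨∑ i ∈ hs.toFinset, 2 ^ i, fun z => ?_⟩
  have h := Finset.toFinset_bitIndices_sum_two_pow hs.toFinset
  rw [E_nat, ← Nat.mem_bitIndices, ← List.mem_toFinset, h, Set.Finite.mem_toFinset]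

theorem nat_sat_F (v : ℕ → ℕ) : ∀ γ ∈ Fthy, γ.Realize v := by
  have hfin : ∀ x : ℕ, {z : ℕ | E z x}.Finite := fun x =>
    (Set.finite_Iio x).subset fun z hz => E_lt hz
  intro γ hγ
  rcases hγ with ((hγ | ⟨φ, rfl⟩) | ⟨φ, rfl⟩) | hγ
  · simp only [Set.mem_insert_iff, Set.mem_singleton_iff] at hγ
    rcases hγ with rfl | rfl | rfl | rfl | rfl
    · exact (sat_ext v).2 fun x y => nat_ext
    · exact (sat_pair v).2 fun x y => nat_set (s := {x, y}) (by simp)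
    · refine (sat_union v).2 fun x => nat_set (s := {z | ∃ w, E z w ∧ E w x}) ?_
      refine (Set.finite_Iio x).subset ?_
      rintro z ⟨w, h1, h2⟩
      exact (E_lt h1).trans (E_lt h2)
    · refine (sat_power v).2 fun x => nat_set (s := {z | ∀ w, E w z → E w x}) ?_
      refine (Set.finite_Iic x).subset ?_
      intro z hz
      exact Nat.le_of_testBit hz
    · refine (sat_found v).2 fun x hx => ?_
      classical
      refine ⟨Nat.find hx, Nat.find_spec hx, fun z hz => ?_⟩
      exact Nat.find_min hx (E_lt hz)
  · exact (sat_sep v φ).2 fun x => nat_set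
      (s := {z | E z x ∧ φ.Realize (Function.update v 0 z)}) ((hfin x).subset fun z hz => hz.1)
  · refine (sat_coll v φ).2 fun x hx => ?_
    choose! f hf using hx
    obtain ⟨b, hb⟩ := nat_set ((hfin x).image f)
    exact ⟨b, fun z hz => ⟨f z, (hb _).2 ⟨z, hz, rfl⟩, hf z hz⟩⟩
  · rw [Set.mem_singleton_iff] at hγ
    subst hγ
    refine Formula.realize_not.2 ?_
    rw [sat_infty]
    rintro ⟨x, ⟨y, hy, -⟩, h⟩
    have : ∀ n, ∃ y, n ≤ y ∧ E y x := by
      intro n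
      induction n with
      | zero => exact ⟨y, by omega, hy⟩
      | succ n ih =>
        obtain ⟨y, hn, hy⟩ := ih
        obtain ⟨s, hs, hs'⟩ := h y hy
        have := E_lt ((hs' y).2 (Or.inr rfl))
        exact ⟨s, by omega, hs⟩
    obtain ⟨y, h1, h2⟩ := this x
    have := E_lt h2
    omega

/-- The empty assignment. -/
def dE {S : Type} : Empty → S := fun e => e.elim

/-- `y` is a level of the cumulative hierarchy. -/
def Lev {S : Type} [setLang.Structure S] (y : S) : Prop :=
  ∃ h : S, E y h ∧ ∀ u, E u h → (∀ z, ¬ E z u) ∨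
    ∃ w, E w h ∧ ∀ z, E z u ↔ ∀ t, E t z → E t w

/-- The formula expressing that the variable `0` is a level. -/
def levF : setLang.Formula ℕ :=
  bE 1 ((memF SetRel.mem 0 1) ⊓ (bA 2 ((memF SetRel.mem 2 1).imp
    ((bA 3 (Formula.not (memF SetRel.mem 3 2))) ⊔
      (bE 3 ((memF SetRel.mem 3 1) ⊓ (bA 4 ((memF SetRel.mem 4 2).iff
        (bA 5 ((memF SetRel.mem 5 4).imp (memF SetRel.mem 5 3))))))))))) 

theorem sat_levF {S : Type} [setLang.Structure S] (v : ℕ → S) :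
    levF.Realize v ↔ Lev (v 0) := by
  simp [levF, Lev, sat_bA, sat_bE, sat_memF, Function.update]

/-- A formula with named variables, all of which are turned into the bound variable `0`. -/
def toB (φ : setLang.Formula ℕ) : setLang.BoundedFormula Empty 1 :=
  BoundedFormula.relabel (fun _ => (Sum.inr (0 : Fin 1) : Empty ⊕ Fin 1)) φ

theorem sat_toB {S : Type} [setLang.Structure S] (φ : setLang.Formula ℕ) (xs : Fin 1 → S) :
    (toB φ).Realize dE xs ↔ φ.Realize (fun _ => xs 0) := by
  have := BoundedFormula.realize_relabel (φ := φ)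
    (g := fun _ => (Sum.inr (0 : Fin 1) : Empty ⊕ Fin 1)) (v := (dE : Empty → S))
    (xs := (xs : Fin (1 + 0) → S))
  refine this.trans ?_
  unfold Formula.Realize
  apply iff_of_eq
  congr 1
  exact Subsingleton.elim _ _

/-- `Refl ψ x y`: counterexamples to universal subformulas of `ψ` with parameters in `x`
can be found in `y`. -/
def Refl {S : Type} [setLang.Structure S] :
    ∀ {n : ℕ}, setLang.BoundedFormula Empty n → S → S → Prop
  | _, .imp f g, x, y => Refl f x y ∧ Refl g x y
  | n, .all f, x, y => Refl f x y ∧ ∀ xs : Fin n → S, (∀ i, E (xs i) x) →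
      (∀ z, E z y → f.Realize dE (Fin.snoc xs z : Fin (n + 1) → S)) →
      ∀ z, f.Realize dE (Fin.snoc xs z : Fin (n + 1) → S)
  | _, _, _, _ => True

theorem Refl_anti {S : Type} [setLang.Structure S] {n : ℕ} (ψ : setLang.BoundedFormula Empty n)
    {x x' y : S} (h : ∀ z, E z x' → E z x) (hr : Refl ψ x y) : Refl ψ x' y := by
  induction ψ with
  | falsum => trivial
  | equal => trivial
  | rel => trivial
  | imp f g ihf ihg => exact ⟨ihf hr.1, ihg hr.2⟩
  | all f ih => exact ⟨ih hr.1, fun xs hxs => hr.2 xs fun i => h _ (hxs i)⟩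

/-- Atomic membership between arbitrary terms. -/
def memB {L : Language} {α : Type} {n : ℕ} (R : L.Relations 2) (t u : L.Term (α ⊕ Fin n)) :
    L.BoundedFormula α n := R.boundedFormula₂ t u

theorem sat_memB_gen {L : Language} {α S : Type} [L.Structure S] {n : ℕ} (R : L.Relations 2)
    (t u : L.Term (α ⊕ Fin n)) (v : α → S) (xs : Fin n → S) :
    (memB R t u).Realize v xs ↔ Structure.RelMap R
      ![t.realize (Sum.elim v xs), u.realize (Sum.elim v xs)] := by
  unfold memB
  rw [BoundedFormula.realize_rel₂]

theorem sat_memB {α S : Type} [setLang.Structure S] {n : ℕ}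
    (t u : setLang.Term (α ⊕ Fin n)) (v : α → S) (xs : Fin n → S) :
    (memB (L := setLang) SetRel.mem t u).Realize v xs ↔
      E (t.realize (Sum.elim v xs)) (u.realize (Sum.elim v xs)) :=
  sat_memB_gen _ t u v xs

theorem Refl_def {n : ℕ} (ψ : setLang.BoundedFormula Empty n) :
    ∃ ρ : setLang.Formula (Fin 2), ∀ (S : Type) [setLang.Structure S] (v : Fin 2 → S),
      ρ.Realize v ↔ Refl ψ (v 0) (v 1) := by
  induction ψ with
  | falsum => exact ⟨⊤, fun S _ v => by simp [Refl]⟩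
  | equal => exact ⟨⊤, fun S _ v => by simp [Refl]⟩
  | rel => exact ⟨⊤, fun S _ v => by simp [Refl]⟩
  | imp f g ihf ihg =>
    obtain ⟨ρ, hρ⟩ := ihf
    obtain ⟨ρ', hρ'⟩ := ihg
    exact ⟨ρ ⊓ ρ', fun S _ v => by rw [Formula.realize_inf, hρ, hρ']; rfl⟩
  | @all n f ih =>
    obtain ⟨ρ, hρ⟩ := ih
    let f' : setLang.BoundedFormula (Fin 2) (n + 1) := f.subst (fun e => e.elim)
    let χ : setLang.BoundedFormula (Fin 2) n :=
      (BoundedFormula.iInf fun i : Fin n => memB (L := setLang) SetRel.mem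
        (Term.var (Sum.inr i)) (Term.var (Sum.inl 0))).imp
      (((memB (L := setLang) SetRel.mem
        (Term.var (Sum.inr (Fin.last n))) (Term.var (Sum.inl 1))).imp f').all.imp f'.all)
    refine ⟨ρ ⊓ χ.alls, fun S _ v => ?_⟩
    rw [Formula.realize_inf, hρ]
    have hf' : ∀ xs : Fin (n + 1) → S, f'.Realize v xs ↔ f.Realize dE xs := by
      intro xs
      unfold f'
      rw [BoundedFormula.realize_subst]
      apply iff_of_eq
      congr 1
      exact Subsingleton.elim _ _
    refine and_congr Iff.rfl ?_
    rw [BoundedFormula.realize_alls]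
    refine forall_congr' fun xs => ?_
    unfold χ
    simp only [BoundedFormula.realize_imp, BoundedFormula.realize_iInf,
      BoundedFormula.realize_all, sat_memB, hf']
    simp

theorem nat_Refl {n : ℕ} (ψ : setLang.BoundedFormula Empty n) (x : ℕ) :
    ∃ B : ℕ, ∀ y : ℕ, (∀ z < B, E z y) → Refl ψ x y := by
  induction ψ with
  | falsum => exact ⟨0, fun y _ => trivial⟩
  | equal => exact ⟨0, fun y _ => trivial⟩
  | rel => exact ⟨0, fun y _ => trivial⟩
  | imp f g ihf ihg =>
    obtain ⟨B, hB⟩ := ihf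
    obtain ⟨B', hB'⟩ := ihg
    exact ⟨max B B', fun y hy => ⟨hB y fun z hz => hy z (lt_max_of_lt_left hz),
      hB' y fun z hz => hy z (lt_max_of_lt_right hz)⟩⟩
  | @all n f ih =>
    obtain ⟨B, hB⟩ := ih
    have hfin : {xs : Fin n → ℕ | ∀ i, E (xs i) x}.Finite := by
      refine (Set.Finite.pi (t := fun _ : Fin n => Set.Iio x) fun _ => Set.finite_Iio x).subset ?_
      intro xs hxs i _
      exact E_lt (hxs i)
    have : ∀ xs : Fin n → ℕ, ∃ z : ℕ, f.Realize dE (Fin.snoc xs z : Fin (n + 1) → ℕ) →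
        ∀ z, f.Realize dE (Fin.snoc xs z : Fin (n + 1) → ℕ) := by
      intro xs
      by_cases h : ∀ z, f.Realize dE (Fin.snoc xs z : Fin (n + 1) → ℕ)
      · exact ⟨0, fun _ => h⟩
      · push Not at h
        obtain ⟨z, hz⟩ := h
        exact ⟨z, fun h => absurd h hz⟩
    choose w hw using this
    obtain ⟨C, hC⟩ := (hfin.image w).bddAbove
    refine ⟨max B (C + 1), fun y hy => ⟨hB y fun z hz => hy z (lt_max_of_lt_left hz), ?_⟩⟩
    intro xs hxs hall
    refine hw xs (hall _ (hy _ (lt_max_of_lt_right ?_)))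
    exact Nat.lt_succ_of_le (hC ⟨xs, hxs, rfl⟩)

/-- The levels in Ackermann's model. -/
def Vn : ℕ → ℕ
  | 0 => 0
  | n + 1 => 2 ^ (Vn n + 1) - 1

theorem E_Vn_succ (n z : ℕ) : E z (Vn (n + 1)) ↔ z ≤ Vn n := by
  rw [E_nat, Vn, Nat.testBit_two_pow_sub_one]
  simp

theorem Vn_lt (n : ℕ) : Vn n < Vn (n + 1) := E_lt ((E_Vn_succ n _).2 le_rfl)

theorem Vn_mono : StrictMono Vn := strictMono_nat_of_lt_succ Vn_lt

theorem E_zero (z : ℕ) : ¬ E z (0 : ℕ) := fun h => absurd (E_lt h) (by omega)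

theorem sub_Vn (n z : ℕ) : (∀ t, E t z → E t (Vn n)) ↔ z ≤ Vn n := by
  constructor
  · exact fun h => Nat.le_of_testBit h
  · intro h t ht
    have h1 := E_lt ht
    cases n with
    | zero => simp only [Vn] at h; omega
    | succ n =>
      rw [E_Vn_succ]
      by_contra hcon
      have h2 : 2 ^ t ≤ z := Nat.ge_two_pow_of_testBit ht
      have h3 : 2 ^ (Vn n + 1) ≤ 2 ^ t := Nat.pow_le_pow_right (by omega) (by omega)
      have h4 : 0 < 2 ^ (Vn n + 1) := by positivity
      simp only [Vn] at h
      omega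

theorem nat_Lev (y : ℕ) : Lev y ↔ ∃ n, y = Vn n := by
  constructor
  · rintro ⟨h, hy, hh⟩
    induction y using Nat.strong_induction_on with
    | _ y ih =>
      rcases hh y hy with h0 | ⟨w, hw, hw'⟩
      · refine ⟨0, nat_ext fun z => ?_⟩
        exact iff_of_false (h0 z) (E_zero z)
      · obtain ⟨n, rfl⟩ := ih w (E_lt ((hw' w).2 fun t ht => ht)) hw
        refine ⟨n + 1, nat_ext fun z => ?_⟩
        rw [hw', E_Vn_succ, sub_Vn]
  · rintro ⟨n, rfl⟩
    obtain ⟨h, hh⟩ := nat_set ((Set.finite_Iic n).image Vn)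
    refine ⟨h, (hh _).2 ⟨n, by simp, rfl⟩, fun u hu => ?_⟩
    obtain ⟨k, hk, rfl⟩ := (hh _).1 hu
    cases k with
    | zero => exact Or.inl E_zero
    | succ k =>
      refine Or.inr ⟨Vn k, (hh _).2 ⟨k, ?_, rfl⟩, fun z => ?_⟩
      · simp only [Set.mem_Iic] at hk ⊢; omega
      · rw [E_Vn_succ, sub_Vn]

theorem nat_Lev_trans {x y z : ℕ} (hy : Lev y) (h1 : E z x) (h2 : E x y) : E z y := by
  obtain ⟨n, rfl⟩ := (nat_Lev y).1 hy
  cases n with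
  | zero => exact absurd h2 (E_zero _)
  | succ n =>
    rw [E_Vn_succ] at h2 ⊢
    exact (E_lt h1).le.trans h2

theorem Vn_mem {m n : ℕ} (h : m < n) : E (Vn m) (Vn n) := by
  obtain ⟨n, rfl⟩ : ∃ k, n = k + 1 := ⟨n - 1, by omega⟩
  rw [E_Vn_succ]
  exact Vn_mono.monotone (by omega)

theorem nat_Lev_lin {x y : ℕ} (hx : Lev x) (hy : Lev y) : E x y ∨ x = y ∨ E y x := by
  obtain ⟨m, rfl⟩ := (nat_Lev x).1 hx
  obtain ⟨n, rfl⟩ := (nat_Lev y).1 hy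
  rcases lt_trichotomy m n with h | rfl | h
  · exact Or.inl (Vn_mem h)
  · exact Or.inr (Or.inl rfl)
  · exact Or.inr (Or.inr (Vn_mem h))

theorem nat_next (ψ : setLang.BoundedFormula Empty 1) (x : ℕ) :
    ∃ y : ℕ, (Lev y ∧ E x y ∧ Refl ψ x y) ∧
      ∀ y' : ℕ, Lev y' ∧ E x y' ∧ Refl ψ x y' → ¬ E y' y := by
  classical
  have : ∃ y : ℕ, Lev y ∧ E x y ∧ Refl ψ x y := by
    obtain ⟨B, hB⟩ := nat_Refl ψ x
    have : ∀ z, z ≤ B + x → E z (Vn (B + x + 1)) := fun z hz =>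
      (E_Vn_succ _ _).2 (hz.trans (Vn_mono.le_apply))
    exact ⟨Vn (B + x + 1), (nat_Lev _).2 ⟨_, rfl⟩, this _ (by omega),
      hB _ fun z hz => this _ (by omega)⟩
  refine ⟨Nat.find this, Nat.find_spec this, fun y' hy' h => ?_⟩
  exact (Nat.find_min this (E_lt h)) (hy')

/-- The union of a chain of levels. -/
def Kof {M : Type} [setLang.Structure M] (d : ℕ → M) : Type := {x : M // ∃ i, E x (d i)}

instance KofStr {M : Type} [setLang.Structure M] (d : ℕ → M) : setLang.Structure (Kof d) :=
  strOf (Kof d) fun x y => E x.1 y.1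

/-- `f` assigns the level `y` to `m`, where `a ∈ y`. -/
def QQ {S : Type} [setLang.Structure S] (a f m y : S) : Prop :=
  E m y ∧ E a y ∧ Lev y ∧ ∃ p, E p f ∧ ∀ z, E z p ↔ z = m ∨ z = y

/-- The second argument reflects above the first. -/
def Sp {S : Type} [setLang.Structure S] (ψ : setLang.BoundedFormula Empty 1) (y y' : S) : Prop :=
  And (E y y') (Refl ψ y y')

/-- The elements of `x` can be assigned reflecting levels above `a`. -/
def JJ {S : Type} [setLang.Structure S] (ψ : setLang.BoundedFormula Empty 1) (a x : S) : Prop :=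
  ∃ f, (∀ m, E m x → ∃ y, QQ a f m y) ∧
    ∀ m m' y y', QQ a f m y → QQ a f m' y' → m = m' ∨ Sp ψ y y' ∨ Sp ψ y' y

/-- The formula for `QQ`, with `a = 1`, `f = 2`. -/
def qqF (m y : ℕ) : setLang.Formula ℕ :=
  (memF SetRel.mem m y) ⊓ ((memF SetRel.mem 1 y) ⊓ ((levF.relabel fun _ => y) ⊓
    bE 7 ((memF SetRel.mem 7 2) ⊓ bA 8 ((memF SetRel.mem 8 7).iff ((eqF 8 m) ⊔ (eqF 8 y))))))

theorem sat_qqF {S : Type} [setLang.Structure S] (v : ℕ → S) (m y : ℕ) (hm : m < 7) (hy : y < 7) :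
    (qqF m y).Realize v ↔ QQ (v 1) (v 2) (v m) (v y) := by
  have h1 : m ≠ 7 := by omega
  have h2 : m ≠ 8 := by omega
  have h3 : y ≠ 7 := by omega
  have h4 : y ≠ 8 := by omega
  unfold qqF QQ
  simp only [Formula.realize_inf, sat_memF, Formula.realize_relabel, sat_levF, sat_bE, sat_bA,
    Formula.realize_iff, Formula.realize_sup, sat_eqF, Function.comp]
  simp [Function.update, h1, h2, h3, h4]

theorem JJ_def (ψ : setLang.BoundedFormula Empty 1) :
    ∃ φ : setLang.Formula ℕ, ∀ (S : Type) [setLang.Structure S] (v : ℕ → S),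
      φ.Realize v ↔ JJ ψ (v 1) (v 0) := by
  obtain ⟨ρ, hρ⟩ := Refl_def ψ
  refine ⟨bE 2 ((bA 3 ((memF SetRel.mem 3 0).imp (bE 4 (qqF 3 4)))) ⊓
    bA 3 (bA 5 (bA 4 (bA 6 ((qqF 3 4).imp ((qqF 5 6).imp ((eqF 3 5) ⊔
      (((memF SetRel.mem 4 6) ⊓ (ρ.relabel ![4, 6])) ⊔
        ((memF SetRel.mem 6 4) ⊓ (ρ.relabel ![6, 4])))))))))), fun S _ v => ?_⟩
  simp only [Formula.realize_inf, sat_memF, Formula.realize_relabel, sat_bE, sat_bA,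
    Formula.realize_imp, Formula.realize_sup, sat_eqF, Function.comp, hρ,
    sat_qqF _ 3 4 (by omega) (by omega), sat_qqF _ 5 6 (by omega) (by omega)]
  simp [Function.update, JJ, Sp]

section Chain
variable {M : Type} [setLang.Structure M] {d : ℕ → M}

theorem K_E (x y : Kof d) : E x y ↔ E x.1 y.1 := Iff.rfl

theorem d_mono (hlev : ∀ i, Lev (d i)) (hmem : ∀ i, E (d i) (d (i + 1)))
    (htrans : ∀ x y z : M, Lev y → E z x → E x y → E z y) {x : M} {i j : ℕ} (hij : i ≤ j)
    (h : E x (d i)) : E x (d j) := by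
  induction hij with
  | refl => exact h
  | step _ ih => exact htrans _ _ _ (hlev _) ih (hmem _)

theorem K_term {n : ℕ} (t : setLang.Term (Empty ⊕ Fin n)) (xs : Fin n → Kof d) :
    (t.realize (Sum.elim dE xs)).1 = t.realize (Sum.elim dE fun i => (xs i).1) := by
  cases t with
  | var a =>
    cases a with
    | inl a => exact a.elim
    | inr a => rfl
  | func f => exact (f : Empty).elim

theorem K_elem (hlev : ∀ i, Lev (d i)) (hmem : ∀ i, E (d i) (d (i + 1)))
    (htrans : ∀ x y z : M, Lev y → E z x → E x y → E z y)
    {n : ℕ} (ψ : setLang.BoundedFormula Empty n) (h : ∀ i, Refl ψ (d i) (d (i + 1))) :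
    ∀ xs : Fin n → Kof d, ψ.Realize dE xs ↔ ψ.Realize dE fun i => (xs i).1 := by
  induction ψ with
  | falsum => intro xs; exact Iff.rfl
  | equal t u =>
    intro xs
    change t.realize _ = u.realize _ ↔ t.realize _ = u.realize _
    rw [← K_term, ← K_term]
    exact Subtype.ext_iff
  | @rel n l R ts =>
    intro xs
    change Structure.RelMap R _ ↔ Structure.RelMap R _
    cases (R : SetRel l)
    change E _ _ ↔ _
    unfold E
    apply iff_of_eq
    congr 1
    funext i
    rw [← K_term]
    refine Fin.cases rfl (fun j => ?_) i
    refine Fin.cases rfl (fun j => j.elim0) j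
  | imp f g ihf ihg =>
    intro xs
    exact imp_congr (ihf (fun i => (h i).1) xs) (ihg (fun i => (h i).2) xs)
  | @all n f ih =>
    intro xs
    have ih' := ih fun i => (h i).1
    have key : ∀ z : Kof d, f.Realize dE (Fin.snoc xs z : Fin (n + 1) → Kof d) ↔
        f.Realize dE (Fin.snoc (fun i => (xs i).1) z.1 : Fin (n + 1) → M) := by
      intro z
      rw [ih']
      apply iff_of_eq
      congr 1
      funext i
      refine Fin.lastCases ?_ (fun j => ?_) i <;> simp
    rw [BoundedFormula.realize_all, BoundedFormula.realize_all]
    constructor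
    · intro hK
      have hi : ∃ i, ∀ j, E (xs j).1 (d i) := by
        choose k hk using fun j => (xs j).2
        refine ⟨Finset.univ.sup k, fun j => d_mono hlev hmem htrans ?_ (hk j)⟩
        exact Finset.le_sup (Finset.mem_univ j)
      obtain ⟨i, hi⟩ := hi
      exact (h i).2 _ hi fun z hz => (key ⟨z, i + 1, hz⟩).1 (hK _)
    · intro hM z
      exact (key z).2 (hM z.1)

theorem K_Refl (hlev : ∀ i, Lev (d i)) (hmem : ∀ i, E (d i) (d (i + 1)))
    (htrans : ∀ x y z : M, Lev y → E z x → E x y → E z y)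
    {n : ℕ} (ψ : setLang.BoundedFormula Empty n) (h : ∀ i, Refl ψ (d i) (d (i + 1)))
    (x y : Kof d) : Refl ψ x y ↔ Refl ψ x.1 y.1 := by
  induction ψ with
  | falsum => exact Iff.rfl
  | equal t u => exact Iff.rfl
  | rel R ts => exact Iff.rfl
  | imp f g ihf ihg => exact and_congr (ihf fun i => (h i).1) (ihg fun i => (h i).2)
  | @all n f ih =>
    refine and_congr (ih fun i => (h i).1) ?_
    have el := K_elem hlev hmem htrans f fun i => (h i).1
    have key : ∀ (xs : Fin n → Kof d) (z : Kof d),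
        f.Realize dE (Fin.snoc xs z : Fin (n + 1) → Kof d) ↔
        f.Realize dE (Fin.snoc (fun i => (xs i).1) z.1 : Fin (n + 1) → M) := by
      intro xs z
      rw [el]
      apply iff_of_eq
      congr 1
      funext i
      refine Fin.lastCases ?_ (fun j => ?_) i <;> simp
    have key2 : ∀ xs : Fin n → Kof d,
        (∀ z, f.Realize dE (Fin.snoc xs z : Fin (n + 1) → Kof d)) ↔
        ∀ z, f.Realize dE (Fin.snoc (fun i => (xs i).1) z : Fin (n + 1) → M) := by
      intro xs
      have := K_elem hlev hmem htrans f.all h xs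
      rwa [BoundedFormula.realize_all, BoundedFormula.realize_all] at this
    have tr : ∀ (u : Kof d) (z : M), E z u.1 → ∃ i, E z (d i) := by
      rintro u z hz
      obtain ⟨i, hi⟩ := u.2
      exact ⟨i, htrans _ _ _ (hlev i) hz hi⟩
    constructor
    · intro hK xs hxs hall
      let xs' : Fin n → Kof d := fun i => ⟨xs i, tr x _ (hxs i)⟩
      exact (key2 xs').1 (hK xs' hxs fun z hz => (key xs' z).2 (hall _ hz))
    · intro hM xs hxs hall
      exact (key2 xs).2 (hM _ hxs fun z hz => (key xs ⟨z, tr y z hz⟩).1 (hall _ hz))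

end Chain

theorem chain_false {M : Type} [setLang.Structure M] {d : ℕ → M} {θ : setLang.Formula ℕ}
    (hcl : ClosedF θ) (hax : ∀ φ ∈ Fthy, ThmOf {θ} φ)
    (hθ : ∀ v : ℕ → M, θ.Realize v)
    (hlev : ∀ i, Lev (d i)) (hmem : ∀ i, E (d i) (d (i + 1)))
    (hrefl : ∀ i, Refl ((toB θ).imp (toB levF)) (d i) (d (i + 1)))
    (hmin : ∀ i y, Lev y → E (d i) y → Refl ((toB θ).imp (toB levF)) (d i) y → ¬ E y (d (i + 1)))
    (htrans : ∀ x y z : M, Lev y → E z x → E x y → E z y)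
    (hlin : ∀ x y : M, Lev x → Lev y → E x y ∨ x = y ∨ E y x)
    (hcyc : ∀ x y : M, E x y → ¬ E y x)
    {X w : M} (hXd : E X (d 0)) (hwX : E w X) (hinf : {z | E z w}.Infinite)
    (hX : ∀ m, E m X → (∀ z, ¬ E z m) ∨
      ∃ m', E m' X ∧ E m' m ∧ ∀ z, E z m ↔ E z m' ∨ z = m') : False := by
  have hirr : ∀ x : M, ¬ E x x := fun x h => hcyc x x h h
  have dm : ∀ {x : M} {i j : ℕ}, i ≤ j → E x (d i) → E x (d j) := fun hij h =>
    d_mono hlev hmem htrans hij h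
  have tr : ∀ (u : Kof d) (z : M), E z u.1 → ∃ i, E z (d i) := by
    rintro u z hz
    obtain ⟨i, hi⟩ := u.2
    exact ⟨i, htrans _ _ _ (hlev i) hz hi⟩
  set ψ := (toB θ).imp (toB levF) with hψ
  have kRefl := K_Refl hlev hmem htrans ψ hrefl
  have kLev : ∀ y : Kof d, Lev y ↔ Lev y.1 := by
    intro y
    have h1 := K_elem hlev hmem htrans (toB levF) (fun i => (hrefl i).2) fun _ => y
    rwa [sat_toB, sat_toB, sat_levF, sat_levF] at h1
  have kθ : ∀ v : ℕ → Kof d, θ.Realize v := by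
    intro v
    have h1 := K_elem hlev hmem htrans (toB θ) (fun i => (hrefl i).1) fun _ => v 0
    rw [sat_toB, sat_toB] at h1
    have h2 := h1.2 (hθ _)
    refine (realize_congr_free θ _ _ _ fun k hk => ?_).1 h2
    rw [hcl] at hk
    simp at hk
  have kF : ∀ φ ∈ Fthy, ∀ v : ℕ → Kof d, φ.Realize v := fun φ hφ v =>
    thm_sound (hax φ hφ) v fun γ hγ => by
      rw [Set.mem_singleton_iff] at hγ
      exact hγ ▸ kθ v
  let a : Kof d := ⟨d 0, 1, hmem 0⟩
  have kpair : ∀ x y : Kof d, ∃ p, ∀ z, E z p ↔ z = x ∨ z = y :=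
    (sat_pair fun _ => a).1 (kF _ (by simp [Fthy, Sthy, sTheoryOf]) _)
  have kunion : ∀ x : Kof d, ∃ u, ∀ z, E z u ↔ ∃ w, E z w ∧ E w x :=
    (sat_union fun _ => a).1 (kF _ (by simp [Fthy, Sthy, sTheoryOf]) _)
  have kfound : ∀ x : Kof d, (∃ y, E y x) → ∃ y, E y x ∧ ∀ z, E z y → ¬ E z x :=
    (sat_found fun _ => a).1 (kF _ (by simp [Fthy, Sthy, sTheoryOf]) _)
  have ksep : ∀ (φ : setLang.Formula ℕ) (v : ℕ → Kof d), ∀ x, ∃ b, ∀ z, E z b ↔ E z x ∧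
      φ.Realize (Function.update v 0 z) := fun φ v =>
    (sat_sep v φ).1 (kF _ (by
      refine Or.inl (Or.inl (Or.inr ⟨φ, rfl⟩))) _)
  -- adjunction
  have kadj : ∀ x y : Kof d, ∃ u, ∀ z, E z u ↔ E z x ∨ z = y := by
    intro x y
    obtain ⟨s, hs⟩ := kpair y y
    obtain ⟨t, ht⟩ := kpair x s
    obtain ⟨u, hu⟩ := kunion t
    refine ⟨u, fun z => ?_⟩
    rw [hu]
    constructor
    · rintro ⟨w, h1, h2⟩
      rcases (ht w).1 h2 with rfl | rfl
      · exact Or.inl h1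
      · exact Or.inr (by simpa using (hs z).1 h1)
    · rintro (h | h)
      · exact ⟨x, h, (ht x).2 (Or.inl rfl)⟩
      · exact ⟨s, (hs z).2 (Or.inl h), (ht s).2 (Or.inr rfl)⟩
  have J0 : ∀ x : Kof d, (∀ z, ¬ E z x) → JJ ψ a x := by
    intro x hx
    have h1 := hx
    refine ⟨x, fun m hm => absurd hm (hx m), ?_⟩
    rintro m m' y y' ⟨-, -, -, p, hp, -⟩
    exact absurd hp (hx p)
  have Jstep : ∀ x x' m : Kof d, JJ ψ a x → (∀ z, E z x' ↔ E z x ∨ z = m) → JJ ψ a x' := by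
    rintro x x' m ⟨f, hf1, hf2⟩ hx'
    obtain ⟨i1, hi1⟩ := f.2
    obtain ⟨i2, hi2⟩ := m.2
    obtain ⟨i, hfi, hmi, hi0⟩ : ∃ i, E f.1 (d i) ∧ E m.1 (d i) ∧ E (d 0) (d i) :=
      ⟨max (max i1 i2) 1, dm (by omega) hi1, dm (by omega) hi2, dm (by omega) (hmem 0)⟩
    let y : Kof d := ⟨d (i + 1), i + 2, hmem _⟩
    have hmy : E m y := dm (Nat.le_succ i) hmi
    have hay : E a y := dm (Nat.le_succ i) hi0
    have hly : Lev y := (kLev y).2 (hlev _)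
    obtain ⟨p0, hp0⟩ := kpair m y
    obtain ⟨f', hf'⟩ := kadj f p0
    have hnew : QQ a f' m y := ⟨hmy, hay, hly, p0, (hf' _).2 (Or.inr rfl), hp0⟩
    have hold : ∀ m1 y1, QQ a f m1 y1 → QQ a f' m1 y1 := by
      rintro m1 y1 ⟨h1, h2, h3, p, hp, hp'⟩
      exact ⟨h1, h2, h3, p, (hf' _).2 (Or.inl hp), hp'⟩
    have hinv : ∀ m1 y1, QQ a f' m1 y1 → QQ a f m1 y1 ∨ (m1 = m ∧ y1 = y) := by
      rintro m1 y1 ⟨h1, h2, h3, p, hp, hp'⟩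
      rcases (hf' _).1 hp with hp | rfl
      · exact Or.inl ⟨h1, h2, h3, p, hp, hp'⟩
      · right
        have e1 := (hp0 m1).1 ((hp' m1).2 (Or.inl rfl))
        have e2 := (hp0 y1).1 ((hp' y1).2 (Or.inr rfl))
        rcases e1 with rfl | rfl <;> rcases e2 with rfl | rfl
        · exact absurd h1 (hirr _)
        · exact ⟨rfl, rfl⟩
        · exact absurd h1 (hcyc _ _ hmy)
        · exact absurd h1 (hirr _)
    have hcross : ∀ m1 y1, QQ a f m1 y1 → Sp ψ y1 y := by
      rintro m1 y1 ⟨h1, h2, h3, p, hp, hp'⟩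
      have e1 : E p.1 (d i) := htrans _ _ _ (hlev i) hp hfi
      have e2 : E y1.1 p.1 := (hp' y1).2 (Or.inr rfl)
      have e3 : E y1.1 (d i) := htrans _ _ _ (hlev i) e2 e1
      refine ⟨dm (Nat.le_succ i) e3, (kRefl _ _).2 ?_⟩
      exact Refl_anti ψ (fun z hz => htrans _ _ _ (hlev i) hz e3) (hrefl i)
    refine ⟨f', fun m1 hm1 => ?_, fun m1 m2 y1 y2 h1 h2 => ?_⟩
    · rcases (hx' m1).1 hm1 with h | rfl
      · obtain ⟨y1, hy1⟩ := hf1 m1 h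
        exact ⟨y1, hold _ _ hy1⟩
      · exact ⟨y, hnew⟩
    · rcases hinv _ _ h1 with h1 | ⟨rfl, rfl⟩ <;> rcases hinv _ _ h2 with h2 | ⟨rfl, rfl⟩
      · exact hf2 _ _ _ _ h1 h2
      · exact Or.inr (Or.inl (hcross _ _ h1))
      · exact Or.inr (Or.inr (hcross _ _ h2))
      · exact Or.inl rfl
  have Jfin : ∀ x : Kof d, JJ ψ a x → {z : Kof d | E z x}.Finite := by
    classical
    rintro x ⟨f, hf1, hf2⟩
    obtain ⟨i, hfi⟩ := f.2
    have : Nonempty (Kof d) := ⟨a⟩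
    choose! Y hY using hf1
    have hYi : ∀ m, E m x → E (Y m).1 (d i) := by
      intro m hm
      obtain ⟨h1, h2, h3, p, hp, hp'⟩ := hY m hm
      have e1 : E p.1 (d i) := htrans _ _ _ (hlev i) hp hfi
      have e2 : E (Y m).1 p.1 := (hp' _).2 (Or.inr rfl)
      exact htrans _ _ _ (hlev i) e2 e1
    let k : Kof d → ℕ := fun m => Nat.find (Y m).2
    have hk1 : ∀ m, E (Y m).1 (d (k m)) := fun m => Nat.find_spec (Y m).2
    have hk2 : ∀ m j, j < k m → ¬ E (Y m).1 (d j) := fun m j => Nat.find_min (Y m).2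
    have hki : ∀ m, E m x → k m ≤ i := fun m hm => Nat.find_min' _ (hYi m hm)
    have hno : ∀ m m', E m x → E m' x → k m = k m' → ¬ Sp ψ (Y m) (Y m') := by
      rintro m m' hm hm' hkk ⟨hs1, hs2⟩
      obtain ⟨h1, h2, h3, -⟩ := hY m hm
      obtain ⟨h1', h2', h3', -⟩ := hY m' hm'
      rw [kLev] at h3 h3'
      rw [kRefl] at hs2
      rcases hkm : k m with _ | j
      · have := hk1 m
        rw [hkm] at this
        exact hcyc _ _ this h2
      · have hj := hk2 m j (by omega)
        have hmm := hk1 m'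
        rw [← hkk, hkm] at hmm
        have hsub : (∀ z, E z (d j) → E z (Y m).1) ∧ E (d j) (Y m').1 := by
          rcases hlin _ _ h3 (hlev j) with h | h | h
          · exact absurd h hj
          · rw [← h]
            exact ⟨fun z hz => hz, hs1⟩
          · exact ⟨fun z hz => htrans _ _ _ h3 hz h, htrans _ _ _ h3' h hs1⟩
        exact hmin j _ h3' hsub.2 (Refl_anti ψ hsub.1 hs2) hmm
    refine Set.Finite.of_finite_image (f := k) ((Set.finite_Iic i).subset ?_) ?_
    · rintro _ ⟨m, hm, rfl⟩
      exact hki m hm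
    · intro m hm m' hm' hkk
      rcases hf2 _ _ _ _ (hY m hm) (hY m' hm') with h | h | h
      · exact h
      · exact absurd h (hno _ _ hm hm' hkk)
      · exact absurd h (hno _ _ hm' hm hkk.symm)
  obtain ⟨φ, hφ⟩ := JJ_def ψ
  let X' : Kof d := ⟨X, 0, hXd⟩
  let w' : Kof d := ⟨w, tr X' w hwX⟩
  obtain ⟨b, hb⟩ := ksep φ.not (fun _ => a) X'
  have hb' : ∀ z, E z b ↔ E z X' ∧ ¬ JJ ψ a z := by
    intro z
    rw [hb, Formula.realize_not, hφ]
    simp [Function.update]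
  have hwb : E w' b := by
    refine (hb' w').2 ⟨hwX, fun hJ => hinf ?_⟩
    refine ((Jfin _ hJ).image Subtype.val).subset ?_
    intro z hz
    exact ⟨⟨z, tr w' z hz⟩, hz, rfl⟩
  obtain ⟨m, hm, hmm⟩ := kfound b ⟨_, hwb⟩
  obtain ⟨hmX, hmJ⟩ := (hb' m).1 hm
  rcases hX m.1 hmX with h0 | ⟨m', hm'X, hm'm, hsucc⟩
  · exact hmJ (J0 m fun z hz => h0 z.1 hz)
  · let n : Kof d := ⟨m', tr X' m' hm'X⟩
    have hn : JJ ψ a n := by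
      by_contra hcon
      exact hmm n hm'm ((hb' n).2 ⟨hm'X, hcon⟩)
    refine hmJ (Jstep n m n hn fun z => ?_)
    refine (hsucc z.1).trans (or_congr Iff.rfl ?_)
    exact ⟨fun h => Subtype.ext h, fun h => congrArg Subtype.val h⟩

/-- An ultrapower of Ackermann's model. -/
abbrev UM : Type := ((Filter.hyperfilter ℕ : Ultrafilter ℕ) : Filter ℕ).Product fun _ => ℕ

/-- The element of the ultrapower given by a sequence. -/
noncomputable def mkU (f : ℕ → ℕ) : UM := (f : ((Filter.hyperfilter ℕ : Ultrafilter ℕ) : Filter ℕ).Product _)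

theorem mkU_surj (x : UM) : ∃ f, x = mkU f := by
  obtain ⟨f, hf⟩ := Quotient.exists_rep x
  exact ⟨f, hf.symm⟩

theorem mkU_eq (f g : ℕ → ℕ) : mkU f = mkU g ↔
    ∀ᶠ n in (Filter.hyperfilter ℕ : Filter ℕ), f n = g n := Quotient.eq''

theorem los {β : Type} (φ : setLang.Formula β) (x : β → ℕ → ℕ) :
    φ.Realize (fun i => mkU (x i)) ↔
      ∀ᶠ n in (Filter.hyperfilter ℕ : Filter ℕ), φ.Realize fun i => x i n :=
  Ultraproduct.realize_formula_cast φ x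

theorem U_E (f g : ℕ → ℕ) : E (mkU f) (mkU g) ↔
    ∀ᶠ n in (Filter.hyperfilter ℕ : Filter ℕ), E (f n) (g n) := by
  have := los (memF SetRel.mem 0 1) fun i => if i = 0 then f else g
  simpa [sat_memF] using this

theorem U_Lev (f : ℕ → ℕ) : Lev (mkU f) ↔
    ∀ᶠ n in (Filter.hyperfilter ℕ : Filter ℕ), Lev (f n) := by
  have := los levF fun _ => f
  simpa [sat_levF] using this

theorem U_Refl (ψ : setLang.BoundedFormula Empty 1) (f g : ℕ → ℕ) :
    Refl ψ (mkU f) (mkU g) ↔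
    ∀ᶠ n in (Filter.hyperfilter ℕ : Filter ℕ), Refl ψ (f n) (g n) := by
  obtain ⟨ρ, hρ⟩ := Refl_def ψ
  have := los ρ ![f, g]
  simpa [hρ] using this

theorem U_false {θ : setLang.Formula ℕ} (hcl : ClosedF θ) (hth : ThmOf Fthy θ)
    (hax : ∀ φ ∈ Fthy, ThmOf {θ} φ) : False := by
  classical
  choose nx hnx1 hnx2 using nat_next ((toB θ).imp (toB levF))
  have hsucc : ∀ x : ℕ, ∃ u : ℕ, ∀ z, E z u ↔ E z x ∨ z = x := by
    intro x
    refine nat_set (s := {z | E z x ∨ z = x}) ((Set.finite_Iic x).subset ?_)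
    rintro z (h | h)
    · exact (E_lt h).le
    · exact h.le
  choose sc hsc using hsucc
  let o : ℕ → ℕ := fun i => Nat.rec 0 (fun _ x => sc x) i
  have ho : ∀ i z, E z (o (i + 1)) ↔ E z (o i) ∨ z = o i := fun i z => hsc _ z
  have hoE : ∀ i n, i < n → E (o i) (o n) := by
    intro i n h
    induction h with
    | refl => exact (ho _ _).2 (Or.inr rfl)
    | step _ ih => exact (ho _ _).2 (Or.inl ih)
  have hoinj : StrictMono o := fun i n h => E_lt (hoE i n h)
  choose Xn hXn using fun n => nat_set ((Set.finite_Iic n).image o)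
  let dn : ℕ → ℕ → ℕ := fun i => Nat.rec (fun n => nx (Xn n)) (fun _ f n => nx (f n)) i
  have hdn : ∀ i n, dn (i + 1) n = nx (dn i n) := fun i n => rfl
  have hdlev : ∀ i n, Lev (dn i n) := by
    intro i n
    cases i with
    | zero => exact (hnx1 _).1
    | succ i => exact (hnx1 _).1
  refine chain_false (M := UM) (d := fun i => mkU (dn i)) hcl hax ?_ ?_ ?_ ?_ ?_ ?_ ?_ ?_
    (X := mkU Xn) (w := mkU o) ?_ ?_ ?_ ?_
  · intro v
    choose f hf using fun i => mkU_surj (v i)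
    obtain rfl : v = fun i => mkU (f i) := funext hf
    exact (los θ f).2 (Filter.Eventually.of_forall fun n => thm_sound hth _ (nat_sat_F _))
  · exact fun i => (U_Lev _).2 (Filter.Eventually.of_forall fun n => hdlev i n)
  · exact fun i => (U_E _ _).2 (Filter.Eventually.of_forall fun n => (hnx1 _).2.1)
  · exact fun i => (U_Refl _ _ _).2 (Filter.Eventually.of_forall fun n => (hnx1 _).2.2)
  · intro i y h1 h2 h3 h4
    obtain ⟨f, rfl⟩ := mkU_surj y
    rw [U_Lev] at h1
    rw [U_E] at h2 h4
    rw [U_Refl] at h3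
    obtain ⟨n, ⟨⟨h1, h2⟩, h3⟩, h4⟩ := (((h1.and h2).and h3).and h4).exists
    exact hnx2 _ _ ⟨h1, h2, h3⟩ h4
  · intro x y z h1 h2 h3
    obtain ⟨x, rfl⟩ := mkU_surj x
    obtain ⟨y, rfl⟩ := mkU_surj y
    obtain ⟨z, rfl⟩ := mkU_surj z
    rw [U_Lev] at h1
    rw [U_E] at h2 h3 ⊢
    filter_upwards [h1, h2, h3] with n h1 h2 h3
    exact nat_Lev_trans h1 h2 h3
  · intro x y h1 h2
    obtain ⟨x, rfl⟩ := mkU_surj x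
    obtain ⟨y, rfl⟩ := mkU_surj y
    rw [U_Lev] at h1 h2
    rw [U_E, U_E, mkU_eq, ← Ultrafilter.eventually_or, ← Ultrafilter.eventually_or]
    filter_upwards [h1, h2] with n h1 h2
    exact nat_Lev_lin h1 h2
  · intro x y h1 h2
    obtain ⟨x, rfl⟩ := mkU_surj x
    obtain ⟨y, rfl⟩ := mkU_surj y
    rw [U_E] at h1 h2
    obtain ⟨n, h1, h2⟩ := (h1.and h2).exists
    exact absurd (E_lt h1) (E_lt h2).asymm
  · exact (U_E _ _).2 (Filter.Eventually.of_forall fun n => (hnx1 _).2.1)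
  · exact (U_E _ _).2 (Filter.Eventually.of_forall fun n => (hXn n _).2 ⟨n, le_refl n, rfl⟩)
  · refine Set.infinite_of_injective_forall_mem (f := fun i : ℕ => mkU fun _ => o i) ?_ ?_
    · intro i j hij
      obtain ⟨n, hn⟩ := ((mkU_eq _ _).1 hij).exists
      exact hoinj.injective hn
    · intro i
      refine (U_E _ _).2 ?_
      have : ∀ᶠ n in Filter.cofinite, i < n := by
        rw [Nat.cofinite_eq_atTop]
        exact Filter.eventually_gt_atTop i
      exact (this.filter_mono Filter.hyperfilter_le_cofinite).mono fun n hn => hoE i n hn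
  · intro m hm
    obtain ⟨f, rfl⟩ := mkU_surj m
    rw [U_E] at hm
    by_cases h0 : ∀ᶠ n in (Filter.hyperfilter ℕ : Filter ℕ), f n = 0
    · left
      intro z hz
      obtain ⟨z, rfl⟩ := mkU_surj z
      rw [U_E] at hz
      obtain ⟨n, h1, h2⟩ := (h0.and hz).exists
      rw [h1] at h2
      exact E_zero _ h2
    · right
      have h0' : ∀ᶠ n in (Filter.hyperfilter ℕ : Filter ℕ), ¬ f n = 0 :=
        Ultrafilter.eventually_not.2 h0
      have hg : ∀ n, ∃ g : ℕ, E (f n) (Xn n) → ¬ f n = 0 →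
          E g (Xn n) ∧ E g (f n) ∧ ∀ z, E z (f n) ↔ E z g ∨ z = g := by
        intro n
        by_cases h : E (f n) (Xn n)
        · obtain ⟨k, hk, hk'⟩ := (hXn n _).1 h
          cases k with
          | zero => exact ⟨0, fun _ h => absurd hk'.symm h⟩
          | succ k =>
            refine ⟨o k, fun _ _ => ⟨(hXn n _).2 ⟨k, ?_, rfl⟩, ?_, ?_⟩⟩
            · simp only [Set.mem_Iic] at hk ⊢
              omega
            · rw [← hk']
              exact hoE _ _ (Nat.lt_succ_self k)
            · rw [← hk']
              exact ho k
        · exact ⟨0, fun h' => absurd h' h⟩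
      choose g hg using hg
      have hall := (hm.and h0').mono fun n hn => hg n hn.1 hn.2
      refine ⟨mkU g, (U_E _ _).2 (hall.mono fun n hn => hn.1),
        (U_E _ _).2 (hall.mono fun n hn => hn.2.1), fun z => ?_⟩
      obtain ⟨z, rfl⟩ := mkU_surj z
      rw [U_E, U_E, mkU_eq, ← Ultrafilter.eventually_or]
      exact Filter.eventually_congr (hall.mono fun n hn => hn.2.2 _)

end Helpers

/-- If `ZF` is consistent, then `ZF` minus the axiom of infinity plus the
negation of infinity (essentially first-order Peano arithmetic) is not finitely
axiomatizable: there is no single sentence `θ` provable from this theory that implies all of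
its axioms. -/
theorem F_not_finitely_axiomatizable (hcon : ConsistentT ZFthy) :
    ¬ ∃ θ : setLang.Formula ℕ, ClosedF θ ∧ ThmOf Fthy θ ∧
      ∀ φ ∈ Fthy, ThmOf {θ} φ := by
  rintro ⟨θ, hcl, hth, hax⟩
  exact U_false hcl hth hax

end PaperZF
end
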